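/- arXiv:0808.2703 — 4 statements merged into one kernel-verified Lean document; each statement's English description precedes it below -/
import Mathlib

section
/- Fix ε_s > 0 and p ∈ (0,1]. Consider the noiseless discrete-time Poisson channel with binary input taking the value 0 with probability 1−p and the value 1/p with probability p. Then the mutual information I_b(p) = ∑_{x∈{0,1/p}} P(x) ∑_{y=0}^∞ Q_{ε_s}(y|x) log( Q_{ε_s}(y|x) / ((1−p)Q_{ε_s}(y|0) + p Q_{ε_s}(y|1/p)) ) admits the closed form I_b(p) = −(p − p e^{−ε_s/p}) log p − ε_s e^{−ε_s/p} − (1 − p + p e^{−ε_s/p}) log(1 − p + p e^{−ε_s/p}). -/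
open Real Filter

/-- Transition probability of the noiseless discrete-time Poisson channel:
`Q_{εs}(y|x) = e^{-εs x} (εs x)^y / y!`. -/
noncomputable def poissonQ (εs x : ℝ) (y : ℕ) : ℝ :=
  Real.exp (-(εs * x)) * (εs * x) ^ y / (y.factorial : ℝ)

/-- The Poisson transition probabilities sum to one. -/
theorem hasSum_poissonQ (εs x : ℝ) : HasSum (poissonQ εs x) 1 := by
  have h := (NormedSpace.expSeries_div_hasSum_exp (εs * x)).mul_left (Real.exp (-(εs * x)))
  rw [← Real.exp_eq_exp_ℝ, ← Real.exp_add, neg_add_cancel, Real.exp_zero] at h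
  refine (congrArg (HasSum · 1) (funext fun y => ?_)).mp h
  simp only [poissonQ, mul_div_assoc]

theorem poissonQ_zero_left (εs : ℝ) (y : ℕ) : poissonQ εs 0 y = if y = 0 then 1 else 0 := by
  cases y <;> simp [poissonQ]

theorem poissonQ_zero_right (εs x : ℝ) : poissonQ εs x 0 = Real.exp (-(εs * x)) := by
  simp [poissonQ]

/-- Closed form of the mutual information of binary on–off signalling (symbols `0` and `1/p`
with probabilities `1-p` and `p`) over the noiseless discrete-time Poisson channel. -/
theorem binary_mutual_information_closed_form
    (εs p : ℝ) (hεs : 0 < εs) (hp : p ∈ Set.Ioc (0 : ℝ) 1) :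
    ((1 - p) * ∑' y : ℕ, poissonQ εs 0 y *
        Real.log (poissonQ εs 0 y /
          ((1 - p) * poissonQ εs 0 y + p * poissonQ εs (1 / p) y)))
      + p * ∑' y : ℕ, poissonQ εs (1 / p) y *
        Real.log (poissonQ εs (1 / p) y /
          ((1 - p) * poissonQ εs 0 y + p * poissonQ εs (1 / p) y))
    = -(p - p * Real.exp (-(εs / p))) * Real.log p - εs * Real.exp (-(εs / p))
        - (1 - p + p * Real.exp (-(εs / p))) *
            Real.log (1 - p + p * Real.exp (-(εs / p))) := by
  obtain ⟨hp0, hp1⟩ := hp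
  have hw : 0 < Real.exp (-(εs / p)) := Real.exp_pos _
  have hQ0 : poissonQ εs (1 / p) 0 = Real.exp (-(εs / p)) := by
    rw [poissonQ_zero_right, mul_one_div]
  have hD : 0 < 1 - p + p * Real.exp (-(εs / p)) := by
    have := mul_pos hp0 hw
    linarith
  have hzero : ∑' y : ℕ, poissonQ εs 0 y * Real.log (poissonQ εs 0 y /
      ((1 - p) * poissonQ εs 0 y + p * poissonQ εs (1 / p) y))
      = -Real.log (1 - p + p * Real.exp (-(εs / p))) := by
    rw [tsum_eq_single 0 fun y hy => by simp [poissonQ_zero_left, hy], hQ0]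
    simp [poissonQ_zero_left]
  have hone : HasSum (fun y : ℕ => poissonQ εs (1 / p) y * Real.log (poissonQ εs (1 / p) y /
      ((1 - p) * poissonQ εs 0 y + p * poissonQ εs (1 / p) y)))
      (1 * -Real.log p + Real.exp (-(εs / p)) *
        (-(εs / p) - Real.log (1 - p + p * Real.exp (-(εs / p))) + Real.log p)) := by
    refine (congrArg (HasSum · _) (funext fun y => ?_)).mp (((hasSum_poissonQ εs (1 / p)).mul_right (-Real.log p)).add
      (hasSum_ite_eq 0 (Real.exp (-(εs / p)) *
        (-(εs / p) - Real.log (1 - p + p * Real.exp (-(εs / p))) + Real.log p))))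
    rcases eq_or_ne y 0 with rfl | hy
    · rw [hQ0, poissonQ_zero_left, if_pos rfl, if_pos rfl, mul_one,
        Real.log_div hw.ne' hD.ne', Real.log_exp]
      ring
    · have hQ : poissonQ εs (1 / p) y ≠ 0 := by
        unfold poissonQ
        positivity
      rw [poissonQ_zero_left, if_neg hy, if_neg hy, mul_zero, zero_add, add_zero,
        div_mul_cancel_right₀ hQ, Real.log_inv]
  rw [hzero, hone.tsum_eq]
  field_simp
  ring
end

section
/- For ε_s ∈ (0,1) let I_b(p) = −(p − p e^{−ε_s/p}) log p − ε_s e^{−ε_s/p} − (1 − p + p e^{−ε_s/p}) log(1 − p + p e^{−ε_s/p}) denote the mutual information of binary on–off signalling over the noiseless discrete-time Poisson channel with off-symbol 0, on-symbol 1/p and on-probability p. Setting p = ε_s, one has I_b(ε_s) = −(1 − e^{−1}) ε_s log ε_s + O(ε_s) as ε_s → 0+; in particular lim_{ε_s→0+} I_b(ε_s) / (ε_s log(1/ε_s)) = 1 − e^{−1}. -/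
open Real Filter Asymptotics

/-- Mutual information of binary on–off signalling (symbols `0` and `1/p` with probabilities
`1-p` and `p`) over the noiseless discrete-time Poisson channel at signal energy `εs`. -/
noncomputable def Ib (εs p : ℝ) : ℝ :=
  -(p - p * Real.exp (-(εs / p))) * Real.log p - εs * Real.exp (-(εs / p))
    - (1 - p + p * Real.exp (-(εs / p))) * Real.log (1 - p + p * Real.exp (-(εs / p)))

theorem Ib_self_add_eq {x : ℝ} (hx : x ≠ 0) :
    Ib x x + (1 - Real.exp (-1)) * x * Real.log x =
      -(x * Real.exp (-1))
        - (1 - x + x * Real.exp (-1)) * Real.log (1 - x + x * Real.exp (-1)) := by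
  rw [Ib, div_self hx]
  ring

theorem Ib_self_add_isBigO :
    (fun x : ℝ => Ib x x + (1 - Real.exp (-1)) * x * Real.log x)
      =O[nhdsWithin 0 (Set.Ioi 0)] fun x : ℝ => x := by
  have hd : DifferentiableAt ℝ (fun x : ℝ => -(x * Real.exp (-1))
      - (1 - x + x * Real.exp (-1)) * Real.log (1 - x + x * Real.exp (-1))) 0 := by
    have h : DifferentiableAt ℝ (fun x : ℝ => 1 - x + x * Real.exp (-1)) 0 := by fun_prop
    exact (by fun_prop : DifferentiableAt ℝ (fun x : ℝ => -(x * Real.exp (-1))) 0).sub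
      (h.mul (h.log (by simp)))
  have hO := hd.isBigO_sub.mono (nhdsWithin_le_nhds (s := Set.Ioi 0))
  simp only [sub_zero, zero_mul, neg_zero, add_zero, Real.log_one, mul_zero] at hO
  refine hO.congr' ?_ EventuallyEq.rfl
  filter_upwards [self_mem_nhdsWithin] with x hx
  exact (Ib_self_add_eq (ne_of_gt hx)).symm

/-- With `p = εs`, binary signalling achieves
`I_b(εs) = -(1 - e⁻¹) εs log εs + O(εs)` as `εs → 0+`; in particular
`lim_{εs→0+} I_b(εs)/(εs log(1/εs)) = 1 - e⁻¹`. -/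
theorem binary_signalling_p_eq_es_asymptotics :
    ((fun εs : ℝ => Ib εs εs + (1 - Real.exp (-1)) * εs * Real.log εs)
        =O[nhdsWithin 0 (Set.Ioi 0)] fun εs : ℝ => εs) ∧
    Tendsto (fun εs : ℝ => Ib εs εs / (εs * Real.log (1 / εs)))
      (nhdsWithin 0 (Set.Ioi 0)) (nhds (1 - Real.exp (-1))) := by
  refine ⟨Ib_self_add_isBigO, ?_⟩
  have hlog : Tendsto (fun x : ℝ => Real.log (1 / x)) (nhdsWithin 0 (Set.Ioi 0)) atTop := by
    simpa only [one_div, Function.comp_def] using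
      Real.tendsto_log_atTop.comp tendsto_inv_nhdsGT_zero
  have hratio : (fun x : ℝ => (Ib x x + (1 - Real.exp (-1)) * x * Real.log x) / x)
      =O[nhdsWithin 0 (Set.Ioi 0)] fun _ => (1 : ℝ) := by
    refine (Ib_self_add_isBigO.mul (isBigO_refl (fun x : ℝ => x⁻¹) _)).congr' ?_ ?_
    · exact Eventually.of_forall fun x => (div_eq_mul_inv _ _).symm
    · filter_upwards [self_mem_nhdsWithin] with x hx
      exact mul_inv_cancel₀ (ne_of_gt hx)
  have hlim := (hratio.mul_isLittleO
    ((isLittleO_one_iff ℝ).2 hlog.inv_tendsto_atTop)).trans_isBigO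
      (isBigO_of_le _ fun _ => (by simp : ‖(1 : ℝ) * 1‖ ≤ ‖(1 : ℝ)‖))
  have hlim := ((isLittleO_one_iff ℝ).1 hlim).const_add (1 - Real.exp (-1))
  rw [add_zero] at hlim
  refine hlim.congr' ?_
  filter_upwards [self_mem_nhdsWithin, hlog.eventually_gt_atTop 0] with x hx hl
  have hx : x ≠ 0 := ne_of_gt hx
  have hl : Real.log x ≠ 0 := by
    intro h
    simp [h] at hl
  simp only [Pi.inv_apply, one_div, Real.log_inv]
  field_simp
  ring
end

section
/- For ε_s ∈ (0,1) small enough that p(ε_s) = −ε_s log ε_s ∈ (0,1), let I_b(p) = −(p − p e^{−ε_s/p}) log p − ε_s e^{−ε_s/p} − (1 − p + p e^{−ε_s/p}) log(1 − p + p e^{−ε_s/p}) denote the mutual information of binary on–off signalling over the noiseless discrete-time Poisson channel with off-symbol 0, on-symbol 1/p and on-probability p. Then I_b(−ε_s log ε_s) = −ε_s log ε_s + o(−ε_s log ε_s) as ε_s → 0+; i.e. lim_{ε_s→0+} I_b(−ε_s log ε_s) / (ε_s log(1/ε_s)) = 1. -/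
open Real Filter

/-- The entropy-type term `-(1 - q) log (1 - q)` is at most `q`. -/
theorem neg_one_sub_mul_log_one_sub_le {q : ℝ} (hq : q < 1) :
    -((1 - q) * Real.log (1 - q)) ≤ q := by
  have h1 : 0 < 1 - q := by linarith
  have h := Real.one_sub_inv_le_log_of_pos h1
  have h2 := mul_le_mul_of_nonneg_left h h1.le
  rw [mul_sub, mul_inv_cancel₀ h1.ne'] at h2
  linarith

/-- `L (1 - exp (-1/L)) → 1` as `L → ∞`. -/
theorem tendsto_mul_one_sub_exp_neg_inv_atTop :
    Tendsto (fun L : ℝ => L * (1 - Real.exp (-L⁻¹))) atTop (nhds 1) := by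
  have hlow : Tendsto (fun L : ℝ => (1 + L⁻¹)⁻¹) atTop (nhds 1) := by
    simpa using (tendsto_inv_atTop_zero (𝕜 := ℝ)).const_add 1 |>.inv₀ (by norm_num)
  refine tendsto_of_tendsto_of_tendsto_of_le_of_le' hlow tendsto_const_nhds ?_ ?_
  · filter_upwards [eventually_gt_atTop 0] with L hL
    have hi : 0 < L⁻¹ := inv_pos.mpr hL
    have h : Real.exp (-L⁻¹) ≤ (1 + L⁻¹)⁻¹ := by
      rw [Real.exp_neg]
      exact inv_anti₀ (by positivity) (by linarith [Real.add_one_le_exp L⁻¹])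
    calc (1 + L⁻¹)⁻¹ = L * (1 - (1 + L⁻¹)⁻¹) := by field_simp; ring
      _ ≤ _ := by gcongr
  · filter_upwards [eventually_gt_atTop 0] with L hL
    calc L * (1 - Real.exp (-L⁻¹)) ≤ L * L⁻¹ := by
          gcongr
          linarith [Real.add_one_le_exp (-L⁻¹)]
      _ = 1 := mul_inv_cancel₀ hL.ne'

/-- The normalised mutual information of flash signalling, in terms of `L = -log εs`. -/
theorem Ib_exp_neg_div {L : ℝ} (hL : 0 < L) :
    Ib (Real.exp (-L)) (Real.exp (-L) * L) / (Real.exp (-L) * L) =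
      L * (1 - Real.exp (-L⁻¹)) * (1 - Real.log L / L) - Real.exp (-L⁻¹) * L⁻¹
        + -((1 - Real.exp (-L) * L * (1 - Real.exp (-L⁻¹))) *
            Real.log (1 - Real.exp (-L) * L * (1 - Real.exp (-L⁻¹)))) / (Real.exp (-L) * L) := by
  have he : 0 < Real.exp (-L) := Real.exp_pos _
  have hu : Real.exp (-L) / (Real.exp (-L) * L) = L⁻¹ := by field_simp
  have hq : 1 - Real.exp (-L) * L + Real.exp (-L) * L * Real.exp (-L⁻¹) =
      1 - Real.exp (-L) * L * (1 - Real.exp (-L⁻¹)) := by ring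
  rw [Ib, hu, hq, Real.log_mul he.ne' hL.ne', Real.log_exp]
  generalize Real.log (1 - _) = z
  generalize Real.exp (-L⁻¹) = y
  field_simp
  ring

/-- Flash signalling in terms of `L = -log εs → ∞`. -/
theorem tendsto_Ib_exp_neg_div_atTop :
    Tendsto (fun L : ℝ => Ib (Real.exp (-L)) (Real.exp (-L) * L) / (Real.exp (-L) * L))
      atTop (nhds 1) := by
  have hinv : Tendsto (fun L : ℝ => L⁻¹) atTop (nhds 0) := tendsto_inv_atTop_zero
  have hexp : Tendsto (fun L : ℝ => Real.exp (-L⁻¹)) atTop (nhds 1) := by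
    simpa [Function.comp_def] using (Real.continuous_exp.tendsto _).comp hinv.neg
  have hlog : Tendsto (fun L : ℝ => Real.log L / L) atTop (nhds 0) :=
    Real.isLittleO_log_id_atTop.tendsto_div_nhds_zero
  have hrest : Tendsto (fun L : ℝ =>
      -((1 - Real.exp (-L) * L * (1 - Real.exp (-L⁻¹))) *
        Real.log (1 - Real.exp (-L) * L * (1 - Real.exp (-L⁻¹)))) / (Real.exp (-L) * L))
      atTop (nhds 0) := by
    have hup : Tendsto (fun L : ℝ => 1 - Real.exp (-L⁻¹)) atTop (nhds 0) := by
      simpa using hexp.const_sub 1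
    refine squeeze_zero' ?_ ?_ hup
    all_goals
      filter_upwards [eventually_gt_atTop 0] with L hL
      have hp : 0 < Real.exp (-L) * L := by positivity
      have ha : 0 < 1 - Real.exp (-L⁻¹) := by
        have : Real.exp (-L⁻¹) < 1 := Real.exp_lt_one_iff.2 (by simpa using hL)
        linarith
      have hq0 : 0 < Real.exp (-L) * L * (1 - Real.exp (-L⁻¹)) := mul_pos hp ha
      have hq1 : Real.exp (-L) * L * (1 - Real.exp (-L⁻¹)) < 1 := by
        have h1 : L * (1 - Real.exp (-L⁻¹)) ≤ 1 := by
          have h := mul_le_mul_of_nonneg_left (Real.add_one_le_exp (-L⁻¹)) hL.le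
          have hc := mul_inv_cancel₀ hL.ne'
          linarith
        have h2 : Real.exp (-L) < 1 := Real.exp_lt_one_iff.2 (by linarith)
        rw [mul_assoc]
        nlinarith [Real.exp_pos (-L)]
    · refine div_nonneg ?_ hp.le
      rw [neg_nonneg]
      exact mul_nonpos_of_nonneg_of_nonpos (by linarith)
        (Real.log_nonpos (by linarith) (by linarith))
    · rw [div_le_iff₀ hp, mul_comm (1 - Real.exp (-L⁻¹))]
      exact neg_one_sub_mul_log_one_sub_le hq1
  have hmain := ((tendsto_mul_one_sub_exp_neg_inv_atTop.mul (hlog.const_sub 1)).sub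
    (hexp.mul hinv)).add hrest
  norm_num at hmain
  refine hmain.congr' ?_
  filter_upwards [eventually_gt_atTop 0] with L hL
  rw [Ib_exp_neg_div hL]

/-- Flash signalling with `p = -εs log εs` asymptotically attains the capacity:
`I_b(-εs log εs) = -εs log εs + o(-εs log εs)` as `εs → 0+`, i.e.
`lim_{εs→0+} I_b(-εs log εs)/(εs log(1/εs)) = 1`. -/
theorem flash_signalling_asymptotics :
    Tendsto (fun εs : ℝ => Ib εs (-(εs * Real.log εs)) / (εs * Real.log (1 / εs)))
      (nhdsWithin 0 (Set.Ioi 0)) (nhds 1) := by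
  have hL : Tendsto (fun εs : ℝ => -Real.log εs) (nhdsWithin 0 (Set.Ioi 0)) atTop :=
    tendsto_neg_atBot_atTop.comp Real.tendsto_log_nhdsGT_zero
  refine (tendsto_Ib_exp_neg_div_atTop.comp hL).congr' ?_
  filter_upwards [self_mem_nhdsWithin] with ε hε
  simp only [Function.comp_apply, neg_neg, Real.exp_log hε, one_div, Real.log_inv, mul_neg]
end

section
/- Fix p ∈ (0,1). Consider the noiseless discrete-time Poisson channel with binary input taking value 0 with probability 1−p and value 1/p with probability p, and let I_b(ε_s) = −(p − p e^{−ε_s/p}) log p − ε_s e^{−ε_s/p} − (1 − p + p e^{−ε_s/p}) log(1 − p + p e^{−ε_s/p}) denote its mutual information at signal energy ε_s. Then as ε_s → 0+, I_b(ε_s) = c₁ ε_s + c₂ ε_s² + o(ε_s²) with c₁ = −log p and c₂ = (1 − p + log p)/(2p); i.e. lim_{ε_s→0+} (I_b(ε_s) + ε_s log p − ε_s² (1 − p + log p)/(2p))/ε_s² = 0. -/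
open Real Filter

/-- A function whose value, derivative and second derivative at `0` all vanish is
`o(x ^ 2)` as `x` tends to `0` from the right. -/
theorem tendsto_div_sq_of_hasDerivAt_zero {f f' : ℝ → ℝ} (hf0 : f 0 = 0) (hf'0 : f' 0 = 0)
    (hf : ∀ᶠ x in nhds 0, HasDerivAt f (f' x) x) (hf' : HasDerivAt f' 0 0) :
    Tendsto (fun x => f x / x ^ 2) (nhdsWithin 0 (Set.Ioi 0)) (nhds 0) := by
  have hpos : ∀ᶠ x : ℝ in nhdsWithin 0 (Set.Ioi 0), x ∈ Set.Ioi (0 : ℝ) := self_mem_nhdsWithin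
  refine HasDerivAt.lhopital_zero_nhdsGT (f' := f') (g' := fun x => 2 * x)
    (hf.filter_mono nhdsWithin_le_nhds)
    (Eventually.of_forall fun x => by simpa using hasDerivAt_pow 2 x) ?_ ?_ ?_ ?_
  · filter_upwards [hpos] with x hx
    exact mul_ne_zero two_ne_zero (ne_of_gt hx)
  · have h := hf.self_of_nhds.continuousAt.tendsto
    rw [hf0] at h
    exact h.mono_left nhdsWithin_le_nhds
  · have h : ContinuousAt (fun x : ℝ => x ^ 2) 0 := by fun_prop
    have h := h.tendsto
    norm_num at h
    exact h.mono_left nhdsWithin_le_nhds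
  · have h := (hasDerivAt_iff_tendsto_slope.mp hf').mono_left
      (nhdsWithin_mono 0 fun x (hx : 0 < x) => hx.ne')
    have h := h.div_const 2
    rw [zero_div] at h
    refine h.congr fun x => ?_
    rw [slope_def_field, hf'0, sub_zero, sub_zero, div_div, mul_comm]

/-- The derivative of `ε ↦ exp (-(ε / p))`. -/
theorem hasDerivAt_exp_neg_div (p x : ℝ) :
    HasDerivAt (fun ε : ℝ => Real.exp (-(ε / p))) (Real.exp (-(x / p)) * -(1 / p)) x :=
  ((hasDerivAt_id x).div_const p).neg.exp

/-- The derivative of the probability `1 - p + p * exp (-(ε / p))` of the output `0`. -/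
theorem hasDerivAt_zero_output_prob {p : ℝ} (hp : p ≠ 0) (x : ℝ) :
    HasDerivAt (fun ε : ℝ => 1 - p + p * Real.exp (-(ε / p))) (-Real.exp (-(x / p))) x := by
  refine (((hasDerivAt_exp_neg_div p x).const_mul p).const_add (1 - p)).congr_deriv ?_
  field_simp

/-- The derivative of `Ib` in the signal energy. -/
theorem hasDerivAt_Ib {p x : ℝ} (hp : p ≠ 0) (hx : 1 - p + p * Real.exp (-(x / p)) ≠ 0) :
    HasDerivAt (fun ε => Ib ε p) (Real.exp (-(x / p)) *
      (-Real.log p + x / p + Real.log (1 - p + p * Real.exp (-(x / p))))) x := by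
  have hu := hasDerivAt_exp_neg_div p x
  have hq := hasDerivAt_zero_output_prob hp x
  refine (((((hu.const_mul p).const_sub p).neg.mul_const (Real.log p)).sub
    ((hasDerivAt_id x).mul hu)).sub (hq.mul (hq.log hx))).congr_deriv ?_
  simp only [id]
  field_simp
  ring

/-- For fixed `p ∈ (0,1)`, binary on–off signalling has low-energy expansion
`I_b(εs) = c₁ εs + c₂ εs² + o(εs²)` with `c₁ = -log p` and `c₂ = (1 - p + log p)/(2p)`. -/
theorem binary_fixed_p_asymptotics (p : ℝ) (hp : p ∈ Set.Ioo (0 : ℝ) 1) :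
    Tendsto (fun εs : ℝ =>
        (Ib εs p - (-Real.log p) * εs - ((1 - p + Real.log p) / (2 * p)) * εs ^ 2) / εs ^ 2)
      (nhdsWithin 0 (Set.Ioi 0)) (nhds 0) := by
  have hp0 : p ≠ 0 := hp.1.ne'
  have hq (x : ℝ) : 1 - p + p * Real.exp (-(x / p)) ≠ 0 :=
    (add_pos (sub_pos.mpr hp.2) (mul_pos hp.1 (Real.exp_pos _))).ne'
  refine tendsto_div_sq_of_hasDerivAt_zero
    (f' := fun x => Real.exp (-(x / p)) *
      (-Real.log p + x / p + Real.log (1 - p + p * Real.exp (-(x / p)))) - -Real.log p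
      - (1 - p + Real.log p) / (2 * p) * (2 * x)) (by simp [Ib]) (by simp)
    (Eventually.of_forall fun x => ?_) ?_
  · refine (((hasDerivAt_Ib hp0 (hq x)).sub ((hasDerivAt_id x).const_mul (-Real.log p))).sub
      ((hasDerivAt_pow 2 x).const_mul ((1 - p + Real.log p) / (2 * p)))).congr_deriv ?_
    simp
  · refine ((((hasDerivAt_exp_neg_div p 0).mul
      ((((hasDerivAt_id (0 : ℝ)).div_const p).const_add (-Real.log p)).add
        ((hasDerivAt_zero_output_prob hp0 0).log (hq 0)))).sub_const (-Real.log p)).sub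
      (((hasDerivAt_id (0 : ℝ)).const_mul 2).const_mul
        ((1 - p + Real.log p) / (2 * p)))).congr_deriv ?_
    simp
    field_simp
    ring
end
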